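/- arXiv:0808.1585 — 2 statements merged into one kernel-verified Lean document; each statement's English description precedes it below -/
import Mathlib

section
/- Let R be an associative ring with unit and let (A, B) be a hereditary complete cotorsion pair in Mod R with pd_A(A) < ∞. Then: (a) A^∧ = {M ∈ Mod R : pd_B(M) < ∞} = P, where P is the class of modules of finite projective dimension; and (b) resdim_A(M) = pd_B(M) for every M ∈ P. -/
noncomputable section

open CategoryTheory CategoryTheory.Limits Opposite DirectSum

universe u

namespace CotorsionDim

variable {R : Type u} [Ring R]

/-- `Ext^n_R(M,N) = 0`. -/
def ExtZero (M N : ModuleCat.{u} R) (n : ℕ) : Prop :=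
  IsZero (((Ext ℤ (ModuleCat.{u} R) n).obj (op M)).obj N)

/-- A pair of composable maps forms a short exact sequence `0 → A → B → C → 0`. -/
def IsSES {A B C : ModuleCat.{u} R} (f : A ⟶ B) (g : B ⟶ C) : Prop :=
  ∃ w : f ≫ g = 0, (CategoryTheory.ShortComplex.mk f g w).ShortExact

/-- relative projective dimension `pd_𝒳(M)` -/
def rpd (𝒳 : Set (ModuleCat.{u} R)) (M : ModuleCat.{u} R) : ℕ∞ :=
  sInf {n : ℕ∞ | ∀ j : ℕ, n < (j : ℕ∞) → ∀ X ∈ 𝒳, ExtZero M X j}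

/-- relative injective dimension `id_𝒳(M)` -/
def rid (𝒳 : Set (ModuleCat.{u} R)) (M : ModuleCat.{u} R) : ℕ∞ :=
  sInf {n : ℕ∞ | ∀ j : ℕ, n < (j : ℕ∞) → ∀ X ∈ 𝒳, ExtZero X M j}

/-- `pd_𝒳(𝒴)` -/
def rpdClass (𝒳 𝒴 : Set (ModuleCat.{u} R)) : ℕ∞ := ⨆ Y : 𝒴, rpd 𝒳 Y

/-- `id_𝒳(𝒴)` -/
def ridClass (𝒳 𝒴 : Set (ModuleCat.{u} R)) : ℕ∞ := ⨆ Y : 𝒴, rid 𝒳 Y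

/-- projective dimension -/
def pd (M : ModuleCat.{u} R) : ℕ∞ := rpd Set.univ M

/-- injective dimension -/
def idim (M : ModuleCat.{u} R) : ℕ∞ := rid Set.univ M

/-- `pd(𝒴)` -/
def pdClass (𝒴 : Set (ModuleCat.{u} R)) : ℕ∞ := ⨆ Y : 𝒴, pd Y.1

/-- `id(𝒴)` -/
def idClass (𝒴 : Set (ModuleCat.{u} R)) : ℕ∞ := ⨆ Y : 𝒴, idim Y.1

/-- `M` has an `𝒳`-resolution `0 → X_n → ⋯ → X_0 → M → 0` of length `n`. -/
def HasResLen (𝒳 : Set (ModuleCat.{u} R)) : ℕ → ModuleCat.{u} R → Prop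
  | 0, M => M ∈ 𝒳
  | n+1, M => ∃ (K X : ModuleCat.{u} R) (f : K ⟶ X) (g : X ⟶ M),
      X ∈ 𝒳 ∧ IsSES f g ∧ HasResLen 𝒳 n K

/-- `M` has an `𝒳`-coresolution `0 → M → X_0 → ⋯ → X_n → 0` of length `n`. -/
def HasCoresLen (𝒳 : Set (ModuleCat.{u} R)) : ℕ → ModuleCat.{u} R → Prop
  | 0, M => M ∈ 𝒳
  | n+1, M => ∃ (X C : ModuleCat.{u} R) (f : M ⟶ X) (g : X ⟶ C),
      X ∈ 𝒳 ∧ IsSES f g ∧ HasCoresLen 𝒳 n C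

/-- `resdim_𝒳(M)` -/
def resdim (𝒳 : Set (ModuleCat.{u} R)) (M : ModuleCat.{u} R) : ℕ∞ :=
  ⨅ n : {n : ℕ // HasResLen 𝒳 n M}, (n : ℕ∞)

/-- `coresdim_𝒳(M)` -/
def coresdim (𝒳 : Set (ModuleCat.{u} R)) (M : ModuleCat.{u} R) : ℕ∞ :=
  ⨅ n : {n : ℕ // HasCoresLen 𝒳 n M}, (n : ℕ∞)

/-- `resdim_𝒳(𝒴)` -/
def resdimClass (𝒳 𝒴 : Set (ModuleCat.{u} R)) : ℕ∞ := ⨆ Y : 𝒴, resdim 𝒳 Y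

/-- `coresdim_𝒳(𝒴)` -/
def coresdimClass (𝒳 𝒴 : Set (ModuleCat.{u} R)) : ℕ∞ := ⨆ Y : 𝒴, coresdim 𝒳 Y

/-- `𝒳^∧`, the class of modules with a finite `𝒳`-resolution. -/
def resClosure (𝒳 : Set (ModuleCat.{u} R)) : Set (ModuleCat.{u} R) :=
  {M | ∃ n, HasResLen 𝒳 n M}

/-- `𝒳^∨`, the class of modules with a finite `𝒳`-coresolution. -/
def coresClosure (𝒳 : Set (ModuleCat.{u} R)) : Set (ModuleCat.{u} R) :=
  {M | ∃ n, HasCoresLen 𝒳 n M}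

/-- `(𝒜, ℬ)` is a cotorsion pair. -/
def IsCotorsionPair (𝒜 ℬ : Set (ModuleCat.{u} R)) : Prop :=
  (∀ M, M ∈ 𝒜 ↔ ∀ B ∈ ℬ, ExtZero M B 1) ∧
  (∀ M, M ∈ ℬ ↔ ∀ A ∈ 𝒜, ExtZero A M 1)

/-- completeness of a cotorsion pair -/
def IsComplete (𝒜 ℬ : Set (ModuleCat.{u} R)) : Prop :=
  ∀ M : ModuleCat.{u} R,
    (∃ (B A : ModuleCat.{u} R) (f : B ⟶ A) (g : A ⟶ M), B ∈ ℬ ∧ A ∈ 𝒜 ∧ IsSES f g) ∧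
    (∃ (B A : ModuleCat.{u} R) (f : M ⟶ B) (g : B ⟶ A), B ∈ ℬ ∧ A ∈ 𝒜 ∧ IsSES f g)

/-- heredity of a cotorsion pair -/
def IsHereditary (𝒜 ℬ : Set (ModuleCat.{u} R)) : Prop :=
  ∀ i : ℕ, 1 ≤ i → ∀ A ∈ 𝒜, ∀ B ∈ ℬ, ExtZero A B i

variable (R)

/-- `𝒫`, the class of modules of finite projective dimension. -/
def P : Set (ModuleCat.{u} R) := {M | pd M < ⊤}

variable {R}

/-- `M` admits a projective resolution consisting of finitely generated projectives,
i.e. `M ∈ mod R`. -/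
def InmodR (M : ModuleCat.{u} R) : Prop :=
  ∃ K : ℕ → ModuleCat.{u} R, K 0 = M ∧ ∀ i : ℕ,
    ∃ (Q : ModuleCat.{u} R) (f : K (i+1) ⟶ Q) (g : Q ⟶ K i),
      Module.Finite R Q ∧ Projective Q ∧ IsSES f g

variable (R)

/-- `𝒫^{<∞} = 𝒫 ∩ mod R`. -/
def Pfin : Set (ModuleCat.{u} R) := {M | pd M < ⊤ ∧ InmodR M}

/-- the big finitistic dimension -/
def bigFindim : ℕ∞ := pdClass (P R)

/-- the little finitistic dimension -/
def littleFindim : ℕ∞ := pdClass (Pfin R)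

variable {R}

/-- `𝒳^{⊥₁}` -/
def rperp1 (𝒳 : Set (ModuleCat.{u} R)) : Set (ModuleCat.{u} R) :=
  {M | ∀ X ∈ 𝒳, ExtZero X M 1}

/-- `^{⊥₁}𝒳` -/
def lperp1 (𝒳 : Set (ModuleCat.{u} R)) : Set (ModuleCat.{u} R) :=
  {M | ∀ X ∈ 𝒳, ExtZero M X 1}

/-- `T^⊥ = {M : Ext^i(T,M) = 0 for all i > 0}` -/
def rperpAll (T : ModuleCat.{u} R) : Set (ModuleCat.{u} R) :=
  {M | ∀ i : ℕ, 0 < i → ExtZero T M i}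

/-- `Add T`: direct summands of arbitrary direct sums of copies of `T`. -/
def AddT (T : ModuleCat.{u} R) : Set (ModuleCat.{u} R) :=
  {M | ∃ (I : Type u) (s : M ⟶ ModuleCat.of R (I →₀ T)) (r : ModuleCat.of R (I →₀ T) ⟶ M),
    s ≫ r = 𝟙 M}

/-- `T` is a tilting module. -/
def IsTilting (T : ModuleCat.{u} R) : Prop :=
  pd T < ⊤ ∧
  (∀ i : ℕ, 0 < i → ∀ I : Type u, ExtZero T (ModuleCat.of R (I →₀ T)) i) ∧
  ∃ n, HasCoresLen (AddT T) n (ModuleCat.of R R)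


/-- `𝒳` is closed under arbitrary direct sums (coproducts). -/
def ClosedUnderCoproducts (𝒳 : Set (ModuleCat.{u} R)) : Prop :=
  ∀ (I : Type u) (f : I → ModuleCat.{u} R), (∀ i, f i ∈ 𝒳) →
    ModuleCat.of R (⨁ i, (f i : Type u)) ∈ 𝒳

/-- `𝒳` is closed under direct summands. -/
def ClosedUnderSummands (𝒳 : Set (ModuleCat.{u} R)) : Prop :=
  ∀ (M N : ModuleCat.{u} R) (s : M ⟶ N) (r : N ⟶ M), s ≫ r = 𝟙 M → N ∈ 𝒳 → M ∈ 𝒳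

lemma extZero_succ_iff (M N : ModuleCat.{u} R) (n : ℕ) :
    ExtZero M N (n + 1) ↔ Subsingleton (Abelian.Ext.{u} M N (n + 1)) := by
  let Q : ProjectiveResolution M := projectiveResolution M
  have hcocycle : ExtZero M N (n + 1) ↔
      ∀ f : Q.complex.X (n + 1) ⟶ N, Q.complex.d (n + 2) (n + 1) ≫ f = 0 →
        ∃ g : Q.complex.X n ⟶ N, Q.complex.d (n + 1) n ≫ g = f := by
    rw [ExtZero, (Q.isoExt (R := ℤ) (n + 1) N).isZero_iff,
      ← HomologicalComplex.exactAt_iff_isZero_homology,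
      HomologicalComplex.exactAt_iff' _ n (n + 1) (n + 2) (by simp) (by simp),
      ShortComplex.moduleCat_exact_iff]
    rfl
  rw [hcocycle, subsingleton_iff_forall_eq 0]
  constructor
  · intro h α
    obtain ⟨f, hf, rfl⟩ := Q.extMk_surjective α (n + 2) rfl
    exact (Q.extMk_eq_zero_iff f (n + 2) rfl hf n rfl).2 (h f hf)
  · intro h f hf
    exact (Q.extMk_eq_zero_iff f (n + 2) rfl hf n rfl).1 (h _)

/-- For `n ≥ 1` and `0 → K → X → M → 0`, if `Ext^n(K,N) = 0` and `Ext^{n+1}(X,N) = 0`, then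
`Ext^{n+1}(M,N) = 0`. -/
lemma ExtZero.of_left_of_middle {K X M N : ModuleCat.{u} R} {f : K ⟶ X} {g : X ⟶ M}
    (h : IsSES f g) {n : ℕ} (hK : ExtZero K N (n + 1)) (hX : ExtZero X N (n + 2)) :
    ExtZero M N (n + 2) := by
  obtain ⟨w, hS⟩ := h
  rw [extZero_succ_iff] at *
  refine (subsingleton_iff_forall_eq 0).2 fun x ↦ ?_
  obtain ⟨y, rfl⟩ := Abelian.Ext.contravariant_sequence_exact₃ hS N x
    (Subsingleton.elim _ _) (n₀ := n + 1) (by lia)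
  rw [Subsingleton.elim y 0, Abelian.Ext.comp_zero]

/-- For `n ≥ 1` and `0 → K → X → M → 0`, if `Ext^n(X,N) = 0` and `Ext^{n+1}(M,N) = 0`, then
`Ext^n(K,N) = 0`. -/
lemma ExtZero.of_middle_of_right {K X M N : ModuleCat.{u} R} {f : K ⟶ X} {g : X ⟶ M}
    (h : IsSES f g) {n : ℕ} (hX : ExtZero X N (n + 1)) (hM : ExtZero M N (n + 2)) :
    ExtZero K N (n + 1) := by
  obtain ⟨w, hS⟩ := h
  rw [extZero_succ_iff] at *
  refine (subsingleton_iff_forall_eq 0).2 fun x ↦ ?_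
  obtain ⟨y, rfl⟩ := Abelian.Ext.contravariant_sequence_exact₁ hS N x
    (n₁ := n + 2) (by lia) (Subsingleton.elim _ _)
  rw [Subsingleton.elim y 0, Abelian.Ext.comp_zero]

/-- For `n ≥ 1` and `0 → K → X → N → 0`, if `Ext^n(M,X) = 0` and `Ext^{n+1}(M,K) = 0`, then
`Ext^n(M,N) = 0`. -/
lemma ExtZero.covariant_of_middle_of_left {K X M N : ModuleCat.{u} R} {f : K ⟶ X} {g : X ⟶ N}
    (h : IsSES f g) {n : ℕ} (hX : ExtZero M X (n + 1)) (hK : ExtZero M K (n + 2)) :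
    ExtZero M N (n + 1) := by
  obtain ⟨w, hS⟩ := h
  rw [extZero_succ_iff] at *
  refine (subsingleton_iff_forall_eq 0).2 fun x ↦ ?_
  obtain ⟨y, rfl⟩ := Abelian.Ext.covariant_sequence_exact₃ M hS x
    (n₁ := n + 2) (by lia) (Subsingleton.elim _ _)
  rw [Subsingleton.elim y 0, Abelian.Ext.zero_comp]

lemma rpd_le_iff (𝒳 : Set (ModuleCat.{u} R)) (M : ModuleCat.{u} R) (n : ℕ) :
    rpd 𝒳 M ≤ n ↔ ∀ j : ℕ, n < j → ∀ X ∈ 𝒳, ExtZero M X j := by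
  constructor
  · intro h j hj
    have hmem : rpd 𝒳 M ∈ {n : ℕ∞ | ∀ j : ℕ, n < (j : ℕ∞) → ∀ X ∈ 𝒳, ExtZero M X j} :=
      csInf_mem ⟨⊤, fun j hj ↦ absurd hj not_top_lt⟩
    exact hmem j (h.trans_lt (by exact_mod_cast hj))
  · intro h
    exact sInf_le fun j hj ↦ h j (by exact_mod_cast hj)

lemma rpd_lt_top_iff (𝒳 : Set (ModuleCat.{u} R)) (M : ModuleCat.{u} R) :
    rpd 𝒳 M < ⊤ ↔ ∃ n : ℕ, rpd 𝒳 M ≤ n := by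
  constructor
  · intro h
    obtain ⟨n, hn⟩ := ENat.ne_top_iff_exists.1 h.ne
    exact ⟨n, hn.ge⟩
  · rintro ⟨n, hn⟩
    exact hn.trans_lt (ENat.natCast_lt_top n)

lemma rpd_mono {𝒳 𝒴 : Set (ModuleCat.{u} R)} (h : 𝒳 ⊆ 𝒴) (M : ModuleCat.{u} R) :
    rpd 𝒳 M ≤ rpd 𝒴 M :=
  sInf_le_sInf fun _ hn j hj X hX ↦ hn j hj X (h hX)

lemma hasResLen_iff_rpd_le {𝒜 ℬ : Set (ModuleCat.{u} R)} (hcp : IsCotorsionPair 𝒜 ℬ)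
    (hcomp : IsComplete 𝒜 ℬ) (hher : IsHereditary 𝒜 ℬ) (n : ℕ) (M : ModuleCat.{u} R) :
    HasResLen 𝒜 n M ↔ rpd ℬ M ≤ n := by
  rw [rpd_le_iff]
  induction n generalizing M with
  | zero =>
    exact ⟨fun hM j hj B hB ↦ hher j hj M hM B hB,
      fun h ↦ (hcp.1 M).2 fun B hB ↦ h 1 one_pos B hB⟩
  | succ n ih =>
    constructor
    · rintro ⟨K, X, f, g, hX, hS, hK⟩ j hj B hB
      obtain ⟨k, rfl⟩ : ∃ k, j = k + 2 := ⟨j - 2, by lia⟩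
      exact .of_left_of_middle hS ((ih K).1 hK _ (by lia) B hB) (hher _ (by lia) X hX B hB)
    · intro h
      obtain ⟨K, X, f, g, -, hX, hS⟩ := (hcomp M).1
      refine ⟨K, X, f, g, hX, hS, (ih K).2 fun j hj B hB ↦ ?_⟩
      obtain ⟨k, rfl⟩ : ∃ k, j = k + 1 := ⟨j - 1, by lia⟩
      exact .of_middle_of_right hS (hher _ (by lia) X hX B hB) (h _ (by lia) B hB)

lemma pd_le_add_of_hasResLen {𝒳 : Set (ModuleCat.{u} R)} {d : ℕ} (hd : ∀ X ∈ 𝒳, pd X ≤ d)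
    (n : ℕ) (M : ModuleCat.{u} R) (hM : HasResLen 𝒳 n M) : pd M ≤ (d + n : ℕ) := by
  induction n generalizing M with
  | zero => exact hd M hM
  | succ n ih =>
    obtain ⟨K, X, f, g, hX, hS, hK⟩ := hM
    refine (rpd_le_iff _ _ _).2 fun j hj N hN ↦ ?_
    obtain ⟨k, rfl⟩ : ∃ k, j = k + 2 := ⟨j - 2, by lia⟩
    exact .of_left_of_middle hS ((rpd_le_iff _ _ _).1 (ih K hK) _ (by lia) N hN)
      ((rpd_le_iff _ _ _).1 (hd X hX) _ (by lia) N hN)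

lemma pd_le_of_rpdClass_le {𝒜 ℬ : Set (ModuleCat.{u} R)} (hcomp : IsComplete 𝒜 ℬ)
    (hher : IsHereditary 𝒜 ℬ) {d : ℕ} (hd : rpdClass 𝒜 𝒜 ≤ d) (A : ModuleCat.{u} R)
    (hA : A ∈ 𝒜) : pd A ≤ d := by
  have hAd : rpd 𝒜 A ≤ d := (le_iSup (fun Y : 𝒜 ↦ rpd 𝒜 Y) ⟨A, hA⟩).trans hd
  refine (rpd_le_iff _ _ _).2 fun j hj N _ ↦ ?_
  obtain ⟨B, X, f, g, hB, hX, hS⟩ := (hcomp N).1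
  obtain ⟨k, rfl⟩ : ∃ k, j = k + 1 := ⟨j - 1, by lia⟩
  exact .covariant_of_middle_of_left hS ((rpd_le_iff _ _ _).1 hAd _ hj X hX)
    (hher _ (by lia) A hA B hB)

lemma resdim_eq_rpd {𝒜 ℬ : Set (ModuleCat.{u} R)} (hcp : IsCotorsionPair 𝒜 ℬ)
    (hcomp : IsComplete 𝒜 ℬ) (hher : IsHereditary 𝒜 ℬ) (M : ModuleCat.{u} R) :
    resdim 𝒜 M = rpd ℬ M := by
  refine le_antisymm ?_ (le_iInf fun n ↦ (hasResLen_iff_rpd_le hcp hcomp hher n.1 M).1 n.2)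
  rcases eq_or_ne (rpd ℬ M) ⊤ with h | h
  · exact h ▸ le_top
  · obtain ⟨n, hn⟩ := ENat.ne_top_iff_exists.1 h
    rw [← hn]
    exact iInf_le (fun n : {n : ℕ // HasResLen 𝒜 n M} ↦ (n : ℕ∞))
      ⟨n, (hasResLen_iff_rpd_le hcp hcomp hher n M).2 hn.ge⟩

/-- Proposition 4.1(a),(b): `𝒜^∧ = {M : pd_ℬ(M) < ∞} = 𝒫` and
`resdim_𝒜(M) = pd_ℬ(M)` for `M ∈ 𝒫`. -/
theorem stmt15 {R : Type u} [Ring R] (𝒜 ℬ : Set (ModuleCat.{u} R))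
    (hcp : IsCotorsionPair 𝒜 ℬ) (hcomp : IsComplete 𝒜 ℬ) (hher : IsHereditary 𝒜 ℬ)
    (hpd : rpdClass 𝒜 𝒜 < ⊤) :
    resClosure 𝒜 = {M : ModuleCat.{u} R | rpd ℬ M < ⊤} ∧
    resClosure 𝒜 = P R ∧
    ∀ M ∈ P R, resdim 𝒜 M = rpd ℬ M := by
  have hfin : resClosure 𝒜 = {M : ModuleCat.{u} R | rpd ℬ M < ⊤} := by
    ext M
    exact (exists_congr fun n ↦ hasResLen_iff_rpd_le hcp hcomp hher n M).trans
      (rpd_lt_top_iff ℬ M).symm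
  refine ⟨hfin, Set.Subset.antisymm ?_ ?_, fun M _ ↦ resdim_eq_rpd hcp hcomp hher M⟩
  · rintro M ⟨n, hM⟩
    obtain ⟨d, hd⟩ := ENat.ne_top_iff_exists.1 hpd.ne
    exact (rpd_lt_top_iff _ M).2
      ⟨d + n, pd_le_add_of_hasResLen (pd_le_of_rpdClass_le hcomp hher hd.ge) n M hM⟩
  · intro M hM
    rw [hfin]
    exact (rpd_mono (Set.subset_univ ℬ) M).trans_lt hM

end CotorsionDim
end
end

section
/- Let R be an associative ring with unit and let (A, B) be a hereditary complete cotorsion pair in Mod R with kernel ω = A ∩ B and pd_A(A) < ∞. Set α := resdim_A(P). Then: (a) α = resdim_A(ω^∧) = resdim_ω(ω^∧) = pd_ω(P) ≤ pd(ω^∧); and (b) pd(ω^∧) = Findim(R). -/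
noncomputable section

open CategoryTheory CategoryTheory.Limits Opposite DirectSum

universe u

namespace CotorsionDim

variable {R : Type u} [Ring R]

variable (R)

variable {R}

variable (R)

variable {R}

/-! ### Comparison with `Abelian.Ext` and dimension shifting -/

/-- In positive degrees, vanishing of `Ext` agrees with vanishing of `Abelian.Ext`. -/
lemma extZero_iff_subsingleton (M N : ModuleCat.{u} R) {n : ℕ} (hn : 0 < n) :
    ExtZero M N n ↔ Subsingleton (Abelian.Ext.{u} M N n) := by
  obtain ⟨k, rfl⟩ := Nat.exists_eq_succ_of_ne_zero hn.ne'
  let Q : ProjectiveResolution M := projectiveResolution M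
  have hcocycle : ExtZero M N (k + 1) ↔
      ∀ f : Q.complex.X (k + 1) ⟶ N, Q.complex.d (k + 2) (k + 1) ≫ f = 0 →
        ∃ g : Q.complex.X k ⟶ N, Q.complex.d (k + 1) k ≫ g = f := by
    unfold ExtZero
    rw [(Q.isoExt (R := ℤ) (k + 1) N).isZero_iff,
      ← HomologicalComplex.exactAt_iff_isZero_homology,
      HomologicalComplex.exactAt_iff' _ k (k + 1) (k + 2) (by simp) (by simp),
      ShortComplex.moduleCat_exact_iff]
    rfl
  rw [Nat.succ_eq_add_one, hcocycle]
  constructor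
  · intro h
    refine subsingleton_of_forall_eq 0 fun α ↦ ?_
    obtain ⟨f, hf, rfl⟩ := Q.extMk_surjective α (k + 2) rfl
    exact (Q.extMk_eq_zero_iff f (k + 2) rfl hf k rfl).2 (h f hf)
  · intro h f hf
    exact (Q.extMk_eq_zero_iff f (k + 2) rfl hf k rfl).1 (Subsingleton.elim _ _)

section ShortExact

variable {K X M Z : ModuleCat.{u} R} {f : K ⟶ X} {g : X ⟶ M} {n : ℕ}

lemma ExtZero.covariant_middle (h : IsSES f g) (hn : 0 < n)
    (h₁ : ExtZero Z K n) (h₃ : ExtZero Z M n) : ExtZero Z X n := by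
  obtain ⟨w, hS⟩ := h
  rw [extZero_iff_subsingleton _ _ hn] at *
  refine subsingleton_of_forall_eq 0 fun x ↦ ?_
  obtain ⟨y, rfl⟩ := Abelian.Ext.covariant_sequence_exact₂ Z hS x (Subsingleton.elim _ _)
  rw [Subsingleton.elim y 0, Abelian.Ext.zero_comp]

lemma ExtZero.covariant_right (h : IsSES f g) (hn : 0 < n)
    (h₂ : ExtZero Z X n) (h₁ : ExtZero Z K (n + 1)) : ExtZero Z M n := by
  obtain ⟨w, hS⟩ := h
  rw [extZero_iff_subsingleton _ _ (by lia)] at *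
  refine subsingleton_of_forall_eq 0 fun x ↦ ?_
  obtain ⟨y, rfl⟩ := Abelian.Ext.covariant_sequence_exact₃ Z hS x rfl (Subsingleton.elim _ _)
  rw [Subsingleton.elim y 0, Abelian.Ext.zero_comp]

lemma ExtZero.contravariant_middle (h : IsSES f g) (hn : 0 < n)
    (h₁ : ExtZero K Z n) (h₃ : ExtZero M Z n) : ExtZero X Z n := by
  obtain ⟨w, hS⟩ := h
  rw [extZero_iff_subsingleton _ _ hn] at *
  refine subsingleton_of_forall_eq 0 fun x ↦ ?_
  obtain ⟨y, rfl⟩ := Abelian.Ext.contravariant_sequence_exact₂ hS Z x (Subsingleton.elim _ _)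
  rw [Subsingleton.elim y 0, Abelian.Ext.comp_zero]

lemma ExtZero.contravariant_right (h : IsSES f g) (hn : 0 < n)
    (h₁ : ExtZero K Z n) (h₂ : ExtZero X Z (n + 1)) : ExtZero M Z (n + 1) := by
  obtain ⟨w, hS⟩ := h
  rw [extZero_iff_subsingleton _ _ (by lia)] at *
  refine subsingleton_of_forall_eq 0 fun x ↦ ?_
  obtain ⟨y, rfl⟩ := Abelian.Ext.contravariant_sequence_exact₃ hS Z x
    (Subsingleton.elim _ _) (add_comm 1 n)
  rw [Subsingleton.elim y 0, Abelian.Ext.comp_zero]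

lemma ExtZero.contravariant_left (h : IsSES f g) (hn : 0 < n)
    (h₂ : ExtZero X Z n) (h₃ : ExtZero M Z (n + 1)) : ExtZero K Z n := by
  obtain ⟨w, hS⟩ := h
  rw [extZero_iff_subsingleton _ _ (by lia)] at *
  refine subsingleton_of_forall_eq 0 fun x ↦ ?_
  obtain ⟨y, rfl⟩ := Abelian.Ext.contravariant_sequence_exact₁ hS Z x
    (add_comm 1 n) (Subsingleton.elim _ _)
  rw [Subsingleton.elim y 0, Abelian.Ext.comp_zero]

lemma projective_of_extZero_one (h : IsSES f g) [Projective X] (hM : ExtZero M K 1) :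
    Projective M := by
  obtain ⟨w, hS⟩ := h
  rw [extZero_iff_subsingleton _ _ one_pos] at hM
  obtain ⟨φ, hφ⟩ := Abelian.Ext.covariant_sequence_exact₃ M hS (Abelian.Ext.mk₀ (𝟙 M))
    (zero_add 1) (Subsingleton.elim _ _)
  obtain ⟨s, rfl⟩ := Abelian.Ext.homEquiv₀.symm.surjective φ
  have hs : s ≫ g = 𝟙 M := Abelian.Ext.homEquiv₀.symm.injective (by simpa using hφ)
  exact (Retract.mk s g hs).projective

end ShortExact

lemma extZero_of_projective (Q Z : ModuleCat.{u} R) [Projective Q] {n : ℕ} (hn : 0 < n) :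
    ExtZero Q Z n := by
  obtain ⟨k, rfl⟩ := Nat.exists_eq_succ_of_ne_zero hn.ne'
  exact isZero_Ext_succ_of_projective Q Z k

lemma exists_projective_ses (M : ModuleCat.{u} R) :
    ∃ (K Q : ModuleCat.{u} R) (f : K ⟶ Q) (g : Q ⟶ M), Projective Q ∧ IsSES f g :=
  ⟨_, _, kernel.ι (Projective.π M), Projective.π M, inferInstance, kernel.condition _,
    { exact := ShortComplex.exact_kernel _ }⟩

/-! ### Bounds on relative dimensions -/

/-- `Ext^j(M, X) = 0` for all `j > n` and `X ∈ 𝒳`. -/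
def VanishesAbove (𝒳 : Set (ModuleCat.{u} R)) (M : ModuleCat.{u} R) (n : ℕ) : Prop :=
  ∀ j : ℕ, n < j → ∀ X ∈ 𝒳, ExtZero M X j

section Bounds

variable {𝒳 𝒴 : Set (ModuleCat.{u} R)} {M : ModuleCat.{u} R}

lemma VanishesAbove.mono {m n : ℕ} (h : VanishesAbove 𝒴 M m) (h𝒳 : 𝒳 ⊆ 𝒴) (hmn : m ≤ n) :
    VanishesAbove 𝒳 M n :=
  fun j hj X hX ↦ h j (hmn.trans_lt hj) X (h𝒳 hX)

lemma rpd_le_iff_s17 {n : ℕ} : rpd 𝒳 M ≤ n ↔ VanishesAbove 𝒳 M n := by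
  constructor
  · intro h j hj X hX
    have hmem : rpd 𝒳 M ∈ {n : ℕ∞ | ∀ j : ℕ, n < (j : ℕ∞) → ∀ X ∈ 𝒳, ExtZero M X j} :=
      csInf_mem ⟨⊤, fun j hj ↦ absurd hj not_top_lt⟩
    exact hmem j (h.trans_lt (by exact_mod_cast hj)) X hX
  · intro h
    exact sInf_le fun j hj ↦ h j (by exact_mod_cast hj)

lemma resdim_le_iff {n : ℕ} : resdim 𝒳 M ≤ n ↔ ∃ k ≤ n, HasResLen 𝒳 k M := by
  constructor
  · intro h
    by_contra! hk
    have : ((n + 1 : ℕ) : ℕ∞) ≤ resdim 𝒳 M :=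
      le_iInf fun k ↦ by
        have := mt (hk k.1) (not_not_intro k.2)
        exact_mod_cast (by lia : n + 1 ≤ k.1)
    have := this.trans h
    norm_cast at this
    lia
  · rintro ⟨k, hkn, hk⟩
    exact (iInf_le _ (⟨k, hk⟩ : {n : ℕ // HasResLen 𝒳 n M})).trans (by exact_mod_cast hkn)

lemma rpdClass_le_iff {n : ℕ} :
    rpdClass 𝒳 𝒴 ≤ n ↔ ∀ M ∈ 𝒴, VanishesAbove 𝒳 M n := by
  simp [rpdClass, iSup_le_iff, rpd_le_iff_s17]

lemma pdClass_le_iff {n : ℕ} :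
    pdClass 𝒴 ≤ n ↔ ∀ M ∈ 𝒴, VanishesAbove Set.univ M n := by
  simp [pdClass, pd, iSup_le_iff, rpd_le_iff_s17]

lemma le_of_forall_natCast {a b : ℕ∞} (h : ∀ n : ℕ, b ≤ n → a ≤ n) : a ≤ b := by
  induction b with
  | top => exact le_top
  | coe n => exact h n le_rfl

lemma eq_of_forall_le_natCast_iff {a b : ℕ∞} (h : ∀ n : ℕ, a ≤ n ↔ b ≤ n) : a = b :=
  le_antisymm (le_of_forall_natCast fun n ↦ (h n).2) (le_of_forall_natCast fun n ↦ (h n).1)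

lemma mem_P_iff : M ∈ P R ↔ ∃ n, VanishesAbove Set.univ M n := by
  constructor
  · intro h
    obtain ⟨n, hn⟩ := ENat.ne_top_iff_exists.1 (ne_of_lt h)
    exact ⟨n, rpd_le_iff_s17.1 hn.ge⟩
  · rintro ⟨n, hn⟩
    exact (rpd_le_iff_s17.2 hn).trans_lt (ENat.natCast_lt_top n)

lemma HasResLen.mono (h : 𝒳 ⊆ 𝒴) {n : ℕ} : ∀ {M}, HasResLen 𝒳 n M → HasResLen 𝒴 n M := by
  induction n with
  | zero => exact fun hM ↦ h hM
  | succ n ih =>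
    rintro M ⟨K, X, f, g, hX, hfg, hK⟩
    exact ⟨K, X, f, g, h hX, hfg, ih hK⟩

lemma HasResLen.vanishesAbove {m : ℕ} (h : ∀ X ∈ 𝒳, VanishesAbove 𝒴 X m) {n : ℕ} :
    ∀ {M}, HasResLen 𝒳 n M → VanishesAbove 𝒴 M (m + n) := by
  induction n with
  | zero => exact fun hM ↦ h _ hM
  | succ n ih =>
    rintro M ⟨K, X, f, g, hX, hfg, hK⟩ j hj Y hY
    obtain ⟨i, rfl⟩ := Nat.exists_eq_succ_of_ne_zero (by lia : j ≠ 0)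
    exact ExtZero.contravariant_right hfg (by lia) (ih hK i (by lia) Y hY)
      (h X hX _ (by lia) Y hY)

lemma VanishesAbove.left_of_ses {K X : ModuleCat.{u} R} {f : K ⟶ X} {g : X ⟶ M}
    (h : IsSES f g) {n : ℕ} (hX : VanishesAbove 𝒳 X n) (hM : VanishesAbove 𝒳 M (n + 1)) :
    VanishesAbove 𝒳 K n :=
  fun j hj Y hY ↦
    ExtZero.contravariant_left h (by lia) (hX j hj Y hY) (hM (j + 1) (by lia) Y hY)

/-- If `𝒳` is closed under syzygies, then `pd_𝒳(M) ≤ n` implies `pd(M) ≤ n` for `M` in `𝒳`. -/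
lemma vanishesAbove_univ_of_syzygy_closed
    (h𝒳 : ∀ {K Q A : ModuleCat.{u} R} {f : K ⟶ Q} {g : Q ⟶ A},
      Projective Q → IsSES f g → A ∈ 𝒳 → K ∈ 𝒳) {n : ℕ} :
    ∀ {M}, M ∈ 𝒳 → VanishesAbove 𝒳 M n → VanishesAbove Set.univ M n := by
  induction n with
  | zero =>
    intro M hM h
    obtain ⟨K, Q, f, g, hQ, hfg⟩ := exists_projective_ses M
    have := projective_of_extZero_one hfg (h 1 one_pos K (h𝒳 hQ hfg hM))
    exact fun j hj X _ ↦ extZero_of_projective M X hj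
  | succ n ih =>
    intro M hM h j hj X hX
    obtain ⟨K, Q, f, g, hQ, hfg⟩ := exists_projective_ses M
    obtain ⟨i, rfl⟩ := Nat.exists_eq_succ_of_ne_zero (by lia : j ≠ 0)
    have hK := ih (h𝒳 hQ hfg hM)
      (VanishesAbove.left_of_ses hfg (fun j hj X _ ↦ extZero_of_projective Q X (by lia)) h)
    exact ExtZero.contravariant_right hfg (by lia) (hK i (by lia) X hX)
      (extZero_of_projective Q X (by lia))

end Bounds

/-! ### Hereditary complete cotorsion pairs -/

section CotorsionPair

variable {𝒜 ℬ : Set (ModuleCat.{u} R)} {M K X : ModuleCat.{u} R} {f : K ⟶ X} {g : X ⟶ M}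

lemma IsHereditary.vanishesAbove (hher : IsHereditary 𝒜 ℬ) (hM : M ∈ 𝒜) :
    VanishesAbove ℬ M 0 :=
  fun j hj B hB ↦ hher j hj M hM B hB

lemma IsCotorsionPair.mem_left_iff (hcp : IsCotorsionPair 𝒜 ℬ) (hher : IsHereditary 𝒜 ℬ) :
    M ∈ 𝒜 ↔ VanishesAbove ℬ M 0 :=
  ⟨hher.vanishesAbove, fun h ↦ (hcp.1 M).2 (h 1 one_pos)⟩

lemma IsCotorsionPair.left_middle_mem (hcp : IsCotorsionPair 𝒜 ℬ) (h : IsSES f g)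
    (hK : K ∈ 𝒜) (hM : M ∈ 𝒜) : X ∈ 𝒜 :=
  (hcp.1 X).2 fun B hB ↦
    ExtZero.contravariant_middle h one_pos ((hcp.1 K).1 hK B hB) ((hcp.1 M).1 hM B hB)

lemma IsCotorsionPair.right_middle_mem (hcp : IsCotorsionPair 𝒜 ℬ) (h : IsSES f g)
    (hK : K ∈ ℬ) (hM : M ∈ ℬ) : X ∈ ℬ :=
  (hcp.2 X).2 fun A hA ↦
    ExtZero.covariant_middle h one_pos ((hcp.2 K).1 hK A hA) ((hcp.2 M).1 hM A hA)

lemma IsCotorsionPair.right_cokernel_mem (hcp : IsCotorsionPair 𝒜 ℬ)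
    (hher : IsHereditary 𝒜 ℬ) (h : IsSES f g) (hK : K ∈ ℬ) (hX : X ∈ ℬ) : M ∈ ℬ :=
  (hcp.2 M).2 fun A hA ↦
    ExtZero.covariant_right h one_pos ((hcp.2 X).1 hX A hA) (hher 2 one_le_two A hA K hK)

lemma IsCotorsionPair.left_kernel_mem (hcp : IsCotorsionPair 𝒜 ℬ)
    (hher : IsHereditary 𝒜 ℬ) (h : IsSES f g) (hX : X ∈ 𝒜) (hM : M ∈ 𝒜) : K ∈ 𝒜 :=
  (hcp.mem_left_iff hher).2 <| (hher.vanishesAbove hX).left_of_ses h <|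
    (hher.vanishesAbove hM).mono subset_rfl zero_le_one

lemma IsCotorsionPair.projective_mem (hcp : IsCotorsionPair 𝒜 ℬ) [Projective M] : M ∈ 𝒜 :=
  (hcp.1 M).2 fun B _ ↦ extZero_of_projective M B one_pos

lemma VanishesAbove.hasResLen_left (hcp : IsCotorsionPair 𝒜 ℬ) (hcomp : IsComplete 𝒜 ℬ)
    (hher : IsHereditary 𝒜 ℬ) {n : ℕ} :
    ∀ {M}, VanishesAbove ℬ M n → HasResLen 𝒜 n M := by
  induction n with
  | zero => exact fun h ↦ (hcp.mem_left_iff hher).2 h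
  | succ n ih =>
    intro M h
    obtain ⟨B, A, f, g, hB, hA, hfg⟩ := (hcomp M).1
    exact ⟨B, A, f, g, hA, hfg, ih <|
      ((hher.vanishesAbove hA).mono subset_rfl n.zero_le).left_of_ses hfg h⟩

lemma VanishesAbove.hasResLen_kernel (hcp : IsCotorsionPair 𝒜 ℬ) (hcomp : IsComplete 𝒜 ℬ)
    (hher : IsHereditary 𝒜 ℬ) {n : ℕ} :
    ∀ {M}, M ∈ ℬ → VanishesAbove ℬ M n → HasResLen (𝒜 ∩ ℬ) n M := by
  induction n with
  | zero => exact fun hM h ↦ ⟨(hcp.mem_left_iff hher).2 h, hM⟩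
  | succ n ih =>
    intro M hM h
    obtain ⟨B, A, f, g, hB, hA, hfg⟩ := (hcomp M).1
    exact ⟨B, A, f, g, ⟨hA, hcp.right_middle_mem hfg hB hM⟩, hfg, ih hB <|
      ((hher.vanishesAbove hA).mono subset_rfl n.zero_le).left_of_ses hfg h⟩

lemma HasResLen.mem_right (hcp : IsCotorsionPair 𝒜 ℬ) (hher : IsHereditary 𝒜 ℬ) {n : ℕ} :
    ∀ {M}, HasResLen (𝒜 ∩ ℬ) n M → M ∈ ℬ := by
  induction n with
  | zero => exact fun hM ↦ hM.2
  | succ n ih =>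
    rintro M ⟨K, X, f, g, hX, hfg, hK⟩
    exact hcp.right_cokernel_mem hher hfg (ih hK) hX.2

/-- The resolution dimension with respect to the left class is the projective dimension relative
to the right class. -/
lemma resdim_left_eq_rpd (hcp : IsCotorsionPair 𝒜 ℬ) (hcomp : IsComplete 𝒜 ℬ)
    (hher : IsHereditary 𝒜 ℬ) (M : ModuleCat.{u} R) : resdim 𝒜 M = rpd ℬ M := by
  refine eq_of_forall_le_natCast_iff fun n ↦ ?_
  rw [resdim_le_iff, rpd_le_iff_s17]
  constructor
  · rintro ⟨k, hk, h⟩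
    exact (h.vanishesAbove fun _ ↦ hher.vanishesAbove).mono subset_rfl (by lia)
  · exact fun h ↦ ⟨n, le_rfl, h.hasResLen_left hcp hcomp hher⟩

lemma resdim_kernel_eq_rpd (hcp : IsCotorsionPair 𝒜 ℬ) (hcomp : IsComplete 𝒜 ℬ)
    (hher : IsHereditary 𝒜 ℬ) (hM : M ∈ ℬ) : resdim (𝒜 ∩ ℬ) M = rpd ℬ M := by
  refine eq_of_forall_le_natCast_iff fun n ↦ ?_
  rw [resdim_le_iff, rpd_le_iff_s17]
  constructor
  · rintro ⟨k, hk, h⟩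
    exact (h.vanishesAbove fun _ hX ↦ hher.vanishesAbove hX.1).mono subset_rfl (by lia)
  · exact fun h ↦ ⟨n, le_rfl, h.hasResLen_kernel hcp hcomp hher hM⟩

lemma VanishesAbove.of_kernel (hcp : IsCotorsionPair 𝒜 ℬ) (hcomp : IsComplete 𝒜 ℬ) {n k : ℕ}
    (hω : VanishesAbove (𝒜 ∩ ℬ) M n) (h : VanishesAbove ℬ M (n + k)) :
    VanishesAbove ℬ M n := by
  induction k with
  | zero => exact h
  | succ k ih =>
    refine ih fun j hj B hB ↦ ?_
    obtain ⟨B', A, f, g, hB', hA, hfg⟩ := (hcomp B).1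
    exact ExtZero.covariant_right hfg (by lia)
      (hω j (by lia) A ⟨hA, hcp.right_middle_mem hfg hB' hB⟩) (h (j + 1) (by lia) B' hB')

lemma rpd_kernel_eq_rpd (hcp : IsCotorsionPair 𝒜 ℬ) (hcomp : IsComplete 𝒜 ℬ)
    (hM : M ∈ P R) : rpd (𝒜 ∩ ℬ) M = rpd ℬ M := by
  obtain ⟨k, hk⟩ := mem_P_iff.1 hM
  refine eq_of_forall_le_natCast_iff fun n ↦ ?_
  rw [rpd_le_iff_s17, rpd_le_iff_s17]
  exact ⟨fun h ↦ h.of_kernel hcp hcomp (hk.mono (Set.subset_univ _) (Nat.le_add_left k n)),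
    fun h ↦ h.mono Set.inter_subset_right le_rfl⟩

lemma vanishesAbove_left_of_kernel (hcp : IsCotorsionPair 𝒜 ℬ) (hcomp : IsComplete 𝒜 ℬ)
    {n k : ℕ} (hω : ∀ W ∈ 𝒜 ∩ ℬ, VanishesAbove Set.univ W n)
    (h : ∀ A ∈ 𝒜, VanishesAbove Set.univ A (n + k)) :
    ∀ A ∈ 𝒜, VanishesAbove Set.univ A n := by
  induction k with
  | zero => exact h
  | succ k ih =>
    refine ih fun A hA ↦ ?_
    obtain ⟨B, A', f, g, hB, hA', hfg⟩ := (hcomp A).2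
    exact ((hω B ⟨hcp.left_middle_mem hfg hA hA', hB⟩).mono subset_rfl (by lia)).left_of_ses hfg
      (h A' hA')

/-- If `pd_𝒜(𝒜) ≤ m` then every module in `𝒜` has projective dimension at most `m`. -/
lemma vanishesAbove_left (hcp : IsCotorsionPair 𝒜 ℬ) (hher : IsHereditary 𝒜 ℬ) {m : ℕ}
    (h : ∀ A ∈ 𝒜, VanishesAbove 𝒜 A m) : ∀ A ∈ 𝒜, VanishesAbove Set.univ A m :=
  fun A hA ↦ vanishesAbove_univ_of_syzygy_closed
    (fun _ hfg hA ↦ hcp.left_kernel_mem hher hfg hcp.projective_mem hA) hA (h A hA)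

lemma resClosure_kernel_subset_P {m : ℕ} (h : ∀ A ∈ 𝒜, VanishesAbove Set.univ A m) :
    resClosure (𝒜 ∩ ℬ) ⊆ P R :=
  fun _ ⟨n, hn⟩ ↦ mem_P_iff.2 ⟨m + n, hn.vanishesAbove fun X hX ↦ h X hX.1⟩

/-- A module of finite projective dimension embeds into a module with a finite resolution by the
kernel, with cokernel in the left class. -/
lemma exists_ses_resClosure_kernel (hcp : IsCotorsionPair 𝒜 ℬ) (hcomp : IsComplete 𝒜 ℬ)
    (hher : IsHereditary 𝒜 ℬ) {m : ℕ} (h : ∀ A ∈ 𝒜, VanishesAbove Set.univ A m)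
    (hM : M ∈ P R) :
    ∃ (B A : ModuleCat.{u} R) (f : M ⟶ B) (g : B ⟶ A),
      B ∈ resClosure (𝒜 ∩ ℬ) ∧ A ∈ 𝒜 ∧ IsSES f g := by
  obtain ⟨k, hk⟩ := mem_P_iff.1 hM
  obtain ⟨B, A, f, g, hB, hA, hfg⟩ := (hcomp M).2
  refine ⟨B, A, f, g, ⟨max k m, ?_⟩, hA, hfg⟩
  refine VanishesAbove.hasResLen_kernel hcp hcomp hher hB fun j hj X _ ↦ ?_
  exact ExtZero.contravariant_middle hfg (by lia) (hk j (by lia) X trivial)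
    (h A hA j (by lia) X trivial)

end CotorsionPair

/-- Lemma 4.2 (specialnum): with `α = resdim_𝒜(𝒫)`,
`α = resdim_𝒜(ω^∧) = resdim_ω(ω^∧) = pd_ω(𝒫) ≤ pd(ω^∧)` and `pd(ω^∧) = Findim(R)`. -/
theorem stmt17 {R : Type u} [Ring R] (𝒜 ℬ ω : Set (ModuleCat.{u} R))
    (hcp : IsCotorsionPair 𝒜 ℬ) (hcomp : IsComplete 𝒜 ℬ) (hher : IsHereditary 𝒜 ℬ)
    (hω : ω = 𝒜 ∩ ℬ) (hpd : rpdClass 𝒜 𝒜 < ⊤) :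
    (resdimClass 𝒜 (P R) = resdimClass 𝒜 (resClosure ω) ∧
      resdimClass 𝒜 (resClosure ω) = resdimClass ω (resClosure ω) ∧
      resdimClass ω (resClosure ω) = rpdClass ω (P R) ∧
      rpdClass ω (P R) ≤ pdClass (resClosure ω)) ∧
    pdClass (resClosure ω) = bigFindim R := by
  subst hω
  obtain ⟨m, hm⟩ := ENat.ne_top_iff_exists.1 hpd.ne
  have hA := vanishesAbove_left hcp hher (rpdClass_le_iff.1 hm.ge)
  have hsub := resClosure_kernel_subset_P (ℬ := ℬ) hA
  have hleft (𝒴 : Set (ModuleCat.{u} R)) : resdimClass 𝒜 𝒴 = rpdClass ℬ 𝒴 :=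
    iSup_congr fun Y ↦ resdim_left_eq_rpd hcp hcomp hher Y
  have hker : resdimClass (𝒜 ∩ ℬ) (resClosure (𝒜 ∩ ℬ)) = rpdClass ℬ (resClosure (𝒜 ∩ ℬ)) :=
    iSup_congr fun ⟨_, _, hY⟩ ↦ resdim_kernel_eq_rpd hcp hcomp hher (hY.mem_right hcp hher)
  have hrpd : rpdClass (𝒜 ∩ ℬ) (P R) = rpdClass ℬ (P R) :=
    iSup_congr fun Y ↦ rpd_kernel_eq_rpd hcp hcomp Y.2
  have hPω : rpdClass ℬ (P R) = rpdClass ℬ (resClosure (𝒜 ∩ ℬ)) := by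
    refine eq_of_forall_le_natCast_iff fun n ↦ ?_
    rw [rpdClass_le_iff, rpdClass_le_iff]
    refine ⟨fun h M hM ↦ h M (hsub hM), fun h M hM ↦ ?_⟩
    obtain ⟨B, A, f, g, hB, hA', hfg⟩ := exists_ses_resClosure_kernel hcp hcomp hher hA hM
    exact (h B hB).left_of_ses hfg ((hher.vanishesAbove hA').mono subset_rfl (Nat.zero_le _))
  rw [hleft, hleft, hker, hrpd, hPω]
  refine ⟨⟨rfl, rfl, rfl, le_of_forall_natCast fun n hn ↦ ?_⟩,
    eq_of_forall_le_natCast_iff fun n ↦ ?_⟩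
  · exact rpdClass_le_iff.2 fun M hM ↦
      (pdClass_le_iff.1 hn M hM).mono (Set.subset_univ _) le_rfl
  · rw [bigFindim, pdClass_le_iff, pdClass_le_iff]
    refine ⟨fun h M hM ↦ ?_, fun h M hM ↦ h M (hsub hM)⟩
    obtain ⟨B, A, f, g, hB, hA', hfg⟩ := exists_ses_resClosure_kernel hcp hcomp hher hA hM
    have hAn := vanishesAbove_left_of_kernel hcp hcomp (fun W hW ↦ h W ⟨0, hW⟩)
      (fun A hA' ↦ (hA A hA').mono subset_rfl (Nat.le_add_left m n))
    exact (h B hB).left_of_ses hfg ((hAn A hA').mono subset_rfl n.le_succ)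

end CotorsionDim
end
end
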